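/- Let D be a probability distribution (PMF) on Fin k, let ε, δ ∈ (0,1), and let m be a natural number with m ≥ (64/ε²)·log(4k/δ). Draw a sample ω : Fin m → Fin k according to the m-fold product of D, and let the empirical frequency be D̂_j(ω) = |{t : ω(t) = j}|/m. Then with probability at least 1 − δ/2, every index i achieving the maximum empirical frequency (i.e., every mode of the empirical distribution, ties broken arbitrarily) satisfies max_j D(j) − D(i) ≤ ε/4. -/

import Mathlib

open MeasureTheory Finset

open ProbabilityTheory in
/-- **Hoeffding's inequality** for the sum of i.i.d. draws of a function with values in an interval
of length one. -/
lemma measureReal_pi_sum_sub_integral_ge_le {α : Type*} [MeasurableSpace α] (μ : Measure α)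
    [IsProbabilityMeasure μ] {f : α → ℝ} (hf : Measurable f) {a : ℝ}
    (hfa : ∀ x, f x ∈ Set.Icc a (a + 1)) (m : ℕ) {s : ℝ} (hs : 0 ≤ s) :
    (Measure.pi fun _ : Fin m => μ).real
        {ω | m * s ≤ ∑ t, (f (ω t) - ∫ x, f x ∂μ)} ≤ Real.exp (-2 * m * s ^ 2) := by
  have hindep : iIndepFun (fun (t : Fin m) (ω : Fin m → α) => f (ω t) - ∫ x, f x ∂μ)
      (Measure.pi fun _ : Fin m => μ) :=
    iIndepFun_pi (X := fun _ x => f x - ∫ x, f x ∂μ)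
      fun _ => (hf.sub_const _).aemeasurable
  have hsub : ∀ t : Fin m, HasSubgaussianMGF
      (fun ω : Fin m → α => f (ω t) - ∫ x, f x ∂μ) (1 / 4)
      (Measure.pi fun _ : Fin m => μ) := by
    intro t
    have hμ : HasSubgaussianMGF (fun x => f x - ∫ x, f x ∂μ) (1 / 4) μ := by
      convert hasSubgaussianMGF_of_mem_Icc (μ := μ) hf.aemeasurable (ae_of_all _ hfa) using 1
      ext
      norm_num
    refine HasSubgaussianMGF.of_map (X := fun x => f x - ∫ x, f x ∂μ)
      (Y := fun ω : Fin m → α => ω t)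
      (measurable_pi_apply t).aemeasurable ?_
    exact (measurePreserving_eval (fun _ : Fin m => μ) t).map_eq.symm ▸ hμ
  refine (HasSubgaussianMGF.measure_sum_ge_le_of_iIndepFun hindep (s := univ)
    (fun t _ => hsub t) (by positivity)).trans_eq ?_
  congr 1
  rcases Nat.eq_zero_or_pos m with rfl | hm
  · simp
  · have : (0 : ℝ) < m := by exact_mod_cast hm
    simp
    field_simp
    norm_num

/-- Two-sided concentration of the empirical frequency of a single outcome. -/
lemma measureReal_pi_abs_card_sub_ge_le {k : ℕ} (D : PMF (Fin k)) (m : ℕ) (j : Fin k) {s : ℝ}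
    (hs : 0 ≤ s) :
    (Measure.pi fun _ : Fin m => D.toMeasure).real
        {ω | m * s ≤ |((univ.filter fun t => ω t = j).card : ℝ) - m * (D j).toReal|} ≤
      2 * Real.exp (-2 * m * s ^ 2) := by
  have hint : ∫ x, (if x = j then (1 : ℝ) else 0) ∂D.toMeasure = (D j).toReal := by
    rw [PMF.integral_eq_sum]
    simp
  have hupper := measureReal_pi_sum_sub_integral_ge_le D.toMeasure
    (f := fun x => if x = j then (1 : ℝ) else 0) (measurable_of_finite _) (a := 0)
    (by intro x; split_ifs <;> norm_num) m hs
  have hlower := measureReal_pi_sum_sub_integral_ge_le D.toMeasure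
    (f := fun x => -if x = j then (1 : ℝ) else 0) (measurable_of_finite _) (a := -1)
    (by intro x; split_ifs <;> norm_num) m hs
  rw [integral_neg, hint] at hlower
  rw [hint] at hupper
  rw [two_mul]
  refine (measureReal_mono ?_).trans ((measureReal_union_le _ _).trans (add_le_add hupper hlower))
  intro ω hω
  have hcard : ((univ.filter fun t => ω t = j).card : ℝ) =
      ∑ t, if ω t = j then (1 : ℝ) else 0 := by simp
  rw [Set.mem_ofPred_eq, hcard, le_abs] at hω
  refine hω.imp (fun h => ?_) (fun h => ?_)
  · simpa [sum_sub_distrib] using h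
  · simpa [sum_add_distrib, sub_eq_add_neg, add_comm] using h

/-- Lemma A.2 (plurality concentration): for an i.i.d. sample of size
`m ≥ (64/ε²)·log(4k/δ)` from a distribution `D` on `Fin k`, with probability at
least `1 − δ/2` every mode `i` of the empirical distribution satisfies
`max_j D(j) − D(i) ≤ ε/4`. -/
theorem stmt_1 (k : ℕ) (hk : 1 ≤ k) (D : PMF (Fin k)) (ε δ : ℝ)
    (hε : 0 < ε) (hε1 : ε < 1) (hδ : 0 < δ) (hδ1 : δ < 1)
    (m : ℕ) (hm : (64 / ε ^ 2) * Real.log (4 * k / δ) ≤ m) :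
    ENNReal.ofReal (1 - δ / 2) ≤
      (Measure.pi fun _ : Fin m => D.toMeasure)
        {ω : Fin m → Fin k | ∀ i : Fin k,
          (∀ j : Fin k, ((univ.filter fun t => ω t = j).card : ℝ) / m ≤
              ((univ.filter fun t => ω t = i).card : ℝ) / m) →
            ∀ j : Fin k, (D j).toReal - (D i).toReal ≤ ε / 4} := by
  have hk0 : (1 : ℝ) ≤ k := by exact_mod_cast hk
  have hratio : 1 < 4 * (k : ℝ) / δ := by
    rw [lt_div_iff₀ hδ]
    linarith
  have hlog : 0 < Real.log (4 * k / δ) := Real.log_pos hratio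
  have hm0 : (0 : ℝ) < m := lt_of_lt_of_le (by positivity) hm
  set P := Measure.pi fun _ : Fin m => D.toMeasure
  set bad : Fin k → Set (Fin m → Fin k) := fun j =>
    {ω | m * (ε / 8) ≤ |((univ.filter fun t => ω t = j).card : ℝ) - m * (D j).toReal|}
  have htail : Real.exp (-2 * m * (ε / 8) ^ 2) ≤ δ / (4 * k) := by
    rw [← Real.le_log_iff_exp_le (by positivity), ← inv_div (4 * (k : ℝ)), Real.log_inv]
    rw [div_mul_eq_mul_div, div_le_iff₀ (by positivity)] at hm
    nlinarith
  have hbad : P.real (⋃ j, bad j) ≤ δ / 2 := by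
    calc P.real (⋃ j, bad j) ≤ ∑ j, P.real (bad j) := measureReal_iUnion_fintype_le _
      _ ≤ ∑ _j : Fin k, 2 * (δ / (4 * k)) := sum_le_sum fun j _ =>
          (measureReal_pi_abs_card_sub_ge_le D m j (by positivity)).trans (by gcongr)
      _ = δ / 2 := by
          simp
          field_simp
          norm_num
  have hcompl : 1 - δ / 2 ≤ P.real (⋃ j, bad j)ᶜ := by
    rw [probReal_compl_eq_one_sub (Set.toFinite _).measurableSet]
    linarith
  refine (ENNReal.ofReal_le_ofReal hcompl).trans ?_
  rw [ofReal_measureReal]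
  refine measure_mono fun ω hω i hi j => ?_
  simp only [bad, Set.mem_compl_iff, Set.mem_iUnion, Set.mem_ofPred_eq, not_exists, not_le] at hω
  have hij := (div_le_div_iff_of_pos_right hm0).1 (hi j)
  have hdevi := (abs_lt.1 (hω i)).2
  have hdevj := (abs_lt.1 (hω j)).1
  refine le_of_mul_le_mul_left ?_ hm0
  linarith
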